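/- Suppose Assumptions 1 and 2 hold and let (x^k, y^k, z^k, u^k, θ_k)_{k≥0} be generated by the constant-parameter algorithm. Then: (a) the sequence θ_k = Ψ(x^k,z^k,u^k;δ,γ)/f(Kx^k) is nonincreasing and converges to some θ̄ ≥ 0; more precisely, with M := sup_{x∈S} f(Kx) < +∞, c₁ := ν, c₂ := δ(2−β)/(2β), c₃ := γ/2, one has θ_{k+1} ≤ θ_k − (1/M)(c₁‖x^k−x^{k+1}‖² + c₂‖u^k−u^{k+1}‖² + c₃‖z^k−z^{k+1}‖²) for all k; (b) ‖x^k−x^{k+1}‖ → 0, ‖u^k−u^{k+1}‖ → 0, ‖z^k−z^{k+1}‖ → 0 as k → ∞; (c) the sequence (x^k, y^k, z^k, u^k) is bounded. -/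

import Mathlib

open Set Filter Topology Metric

open scoped RealInnerProductSpace

noncomputable section

namespace FracPaper

variable {E : Type*} [NormedAddCommGroup E] [InnerProductSpace ℝ E] [FiniteDimensional ℝ E]
variable {F : Type*} [NormedAddCommGroup F] [InnerProductSpace ℝ F] [FiniteDimensional ℝ F]
variable {G : Type*} [NormedAddCommGroup G] [InnerProductSpace ℝ G] [FiniteDimensional ℝ G]

/-- The effective domain of an `EReal`-valued function. -/
def edom (f : E → EReal) : Set E := {x | f x ≠ ⊤}

/-- `f` is proper: it takes values in `ℝ ∪ {+∞}` and is not identically `+∞`. -/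
def ProperFn (f : E → EReal) : Prop := (∀ x, f x ≠ ⊥) ∧ ∃ x, f x ≠ ⊤

/-- Convexity for `EReal`-valued functions. -/
def ConvexFn (f : E → EReal) : Prop :=
  ∀ x y : E, ∀ a b : ℝ, 0 ≤ a → 0 ≤ b → a + b = 1 →
    f (a • x + b • y) ≤ (a : EReal) * f x + (b : EReal) * f y

/-- The Fenchel conjugate of an `EReal`-valued function. -/
def conj (f : E → EReal) : E → EReal :=
  fun v => ⨆ x : E, ((⟪v, x⟫ : EReal) - f x)

/-- The `ε`-subdifferential (for convex functions). -/
def epsSubdiff (f : E → EReal) (ε : ℝ) (w : E) : Set E :=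
  {v | f w ≠ ⊤ ∧ ∀ y : E, f w + ((⟪v, y - w⟫ - ε : ℝ) : EReal) ≤ f y}

/-- The convex subdifferential. -/
def subdiff (f : E → EReal) (w : E) : Set E := epsSubdiff f 0 w

/-- The Fréchet subdifferential. -/
def frechetSubdiff (f : E → EReal) (w : E) : Set E :=
  {v | f w ≠ ⊤ ∧ ∀ ε : ℝ, 0 < ε →
    ∀ᶠ y in nhds w, f w + ((⟪v, y - w⟫ - ε * ‖y - w‖ : ℝ) : EReal) ≤ f y}

/-- The limiting (Mordukhovich) subdifferential. -/
def limitingSubdiff (f : E → EReal) (w : E) : Set E :=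
  {v | ∃ xs vs : ℕ → E,
      Tendsto xs atTop (nhds w) ∧
      Tendsto (fun k => f (xs k)) atTop (nhds (f w)) ∧
      Tendsto vs atTop (nhds v) ∧
      ∀ k, vs k ∈ frechetSubdiff f (xs k)}

open Classical in
/-- The indicator function of a set, with values in `EReal`. -/
def indicatorFn (S : Set E) : E → EReal := fun x => if x ∈ S then (0 : EReal) else ⊤

/-- Calmness of an `EReal`-valued function at a point. -/
def CalmAt (f : E → EReal) (x : E) : Prop :=
  ∃ ε κ : ℝ, 0 < ε ∧ 0 < κ ∧ ∀ y ∈ ball x ε,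
    f y ≤ f x + ((κ * ‖y - x‖ : ℝ) : EReal) ∧ f x ≤ f y + ((κ * ‖y - x‖ : ℝ) : EReal)

/-- Essential strict convexity: strict convexity on every convex subset of `dom ∂g`. -/
def EssStrictConvexFn (g : F → EReal) : Prop :=
  ∀ C : Set F, Convex ℝ C → (∀ w ∈ C, (subdiff g w).Nonempty) →
    ∀ x ∈ C, ∀ y ∈ C, x ≠ y → ∀ a b : ℝ, 0 < a → 0 < b → a + b = 1 →
      g (a • x + b • y) < (a : EReal) * g x + (b : EReal) * g y

/-- The Kurdyka–Łojasiewicz property at a point. -/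
def KLAt (f : E → EReal) (xh : E) : Prop :=
  ∃ μ : ℝ, 0 < μ ∧ ∃ U ∈ nhds xh, ∃ φ φd : ℝ → ℝ,
    ContinuousOn φ (Ico 0 μ) ∧ ConcaveOn ℝ (Ico 0 μ) φ ∧ φ 0 = 0 ∧
    (∀ t ∈ Ioo 0 μ, HasDerivAt φ (φd t) t ∧ 0 < φd t) ∧
    ∀ x ∈ U, f xh < f x → f x < f xh + (μ : EReal) →
      ∀ v ∈ limitingSubdiff f x, 1 ≤ φd ((f x).toReal - (f xh).toReal) * ‖v‖

/-- The augmented function `Ψ`. -/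
def psi (S : Set E) (g : F → EReal) (h : E → ℝ) (A : E →L[ℝ] F) (δ γ : ℝ)
    (x : E) (z : F) (u : E) : EReal :=
  ((⟪z, A x⟫ + h x + δ / 2 * ‖x - u‖ ^ 2 - γ / 2 * ‖z‖ ^ 2 : ℝ) : EReal)
    - conj g z + indicatorFn S x

/-- Assumption 1 of the paper. `h'` is the gradient of `h` and `Lh` its Lipschitz constant. -/
def Assumption1 (S : Set E) (g : F → EReal) (h : E → ℝ) (h' : E → E) (Lh : ℝ)
    (f : G → EReal) (A : E →L[ℝ] F) (K : E →L[ℝ] G) : Prop :=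
  S.Nonempty ∧ Convex ℝ S ∧ IsCompact S ∧
  ProperFn g ∧ ConvexFn g ∧ LowerSemicontinuous g ∧
  (∃ O : Set E, IsOpen O ∧ S ⊆ O ∧ (∀ x ∈ O, HasGradientAt h (h' x) x) ∧
      ∀ x ∈ O, ∀ y ∈ O, ‖h' x - h' y‖ ≤ Lh * ‖x - y‖) ∧
  ProperFn f ∧ ConvexFn f ∧ LowerSemicontinuous f ∧
  (∀ x ∈ S, K x ∈ interior (edom f)) ∧ (∀ x ∈ S, 0 < f (K x)) ∧
  (∃ x ∈ S, A x ∈ edom g) ∧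
  (∃ α : ℝ, 0 < α ∧ ∀ x ∈ S, (α : EReal) ≤ g (A x) + (h x : EReal))

/-- Assumption 2 of the paper. -/
def Assumption2 (S : Set E) (g : F → EReal) (A : E →L[ℝ] F) : Prop :=
  (∀ x ∈ S, (subdiff g (A x)).Nonempty) ∧
  ∃ ℓ : ℝ, 0 < ℓ ∧ ∀ x ∈ S, infDist 0 (subdiff g (A x)) ≤ ℓ

/-- The constant-parameter algorithm (FSPS with fixed `γ`, `δ`, `β`). -/
def IsAlgoSeq (S : Set E) (g : F → EReal) (h : E → ℝ) (h' : E → E) (f : G → EReal)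
    (A : E →L[ℝ] F) (K : E →L[ℝ] G) (γ δ β : ℝ)
    (x u : ℕ → E) (y : ℕ → G) (z : ℕ → F) (θ : ℕ → ℝ) : Prop :=
  x 0 ∈ S ∧
  (∀ k, ∀ ζ : F, conj g (z k) + ((-⟪z k, A (x k)⟫ + γ / 2 * ‖z k‖ ^ 2 : ℝ) : EReal)
      ≤ conj g ζ + ((-⟪ζ, A (x k)⟫ + γ / 2 * ‖ζ‖ ^ 2 : ℝ) : EReal)) ∧
  (∀ k, 0 < θ k ∧ ((θ k : ℝ) : EReal) * f (K (x k)) = psi S g h A δ γ (x k) (z k) (u k)) ∧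
  (∀ k, y (k + 1) ∈ subdiff f (K (x k))) ∧
  (∀ k, x (k + 1) ∈ S ∧ ∀ w ∈ S,
      ⟪z k, A (x (k + 1))⟫ - θ k * ⟪K (x (k + 1)), y (k + 1)⟫
          + ⟪h' (x k), x (k + 1)⟫ + δ / 2 * ‖x (k + 1) - u k‖ ^ 2
        ≤ ⟪z k, A w⟫ - θ k * ⟪K w, y (k + 1)⟫ + ⟪h' (x k), w⟫
          + δ / 2 * ‖w - u k‖ ^ 2) ∧
  (∀ k, u (k + 1) = (1 - β) • u k + β • x (k + 1))

/-- `x̄` is a limiting `(ε₁, ε₂)`-lifted stationary point of the fractional program. -/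
def IsLiftedStat (S : Set E) (g : F → EReal) (h : E → ℝ) (h' : E → E) (f : G → EReal)
    (A : E →L[ℝ] F) (K : E →L[ℝ] G) (ε₁ ε₂ : ℝ) (xb : E) : Prop :=
  ∃ Ψb : ℝ, |Ψb - ((g (A xb)).toReal + h xb)| ≤ ε₂ ∧
    ∃ v ∈ epsSubdiff g ε₁ (A xb), ∃ w ∈ subdiff (indicatorFn S) xb,
      ∃ s ∈ subdiff f (K xb),
        (f (K xb)).toReal • (ContinuousLinearMap.adjoint A v + h' xb + w)
          - Ψb • (ContinuousLinearMap.adjoint K s) = 0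


set_option linter.unusedSectionVars false

/-- A real-valued representative of an `EReal`-valued function at a point where it is finite. -/
theorem exists_coe_eq {a : EReal} (hbot : a ≠ ⊥) (htop : a ≠ ⊤) : ∃ r : ℝ, a = (r : EReal) :=
  ⟨a.toReal, (EReal.coe_toReal htop hbot).symm⟩

/-- A quadratic that is nonnegative near `0` on the right has nonnegative linear coefficient. -/
theorem nonneg_of_forall_linear_add_sq {p q : ℝ}
    (H : ∀ t ∈ Ioo (0 : ℝ) 1, 0 ≤ t * p + t ^ 2 * q) : 0 ≤ p := by
  have hlim : Tendsto (fun t : ℝ => p + t * q) (𝓝[>] 0) (𝓝 p) := by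
    have : Tendsto (fun t : ℝ => p + t * q) (𝓝 0) (𝓝 (p + 0 * q)) :=
      (by fun_prop : Continuous fun t : ℝ => p + t * q).tendsto 0
    rw [zero_mul, add_zero] at this
    exact this.mono_left nhdsWithin_le_nhds
  refine ge_of_tendsto hlim ?_
  filter_upwards [Ioo_mem_nhdsGT (zero_lt_one (α := ℝ))] with t ht
  have h1 : 0 ≤ t * (p + t * q) := by linarith [H t ht, (by ring : t * (p + t * q) = t * p + t ^ 2 * q)]
  exact nonneg_of_mul_nonneg_right h1 ht.1

theorem norm_add_smul_sq (a d : E) (t : ℝ) :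
    ‖a + t • d‖ ^ 2 = ‖a‖ ^ 2 + 2 * t * ⟪a, d⟫ + t ^ 2 * ‖d‖ ^ 2 := by
  rw [norm_add_sq_real, real_inner_smul_right, norm_smul, mul_pow, Real.norm_eq_abs, sq_abs]
  ring

theorem coe_le_conj {g : F → EReal} {w : F} {r : ℝ} (hw : g w = r) (v : F) :
    ((⟪v, w⟫ - r : ℝ) : EReal) ≤ conj g v := by
  rw [EReal.coe_sub, ← hw]
  exact le_iSup (fun x : F => ((⟪v, x⟫ : EReal) - g x)) w

theorem conj_le_coe_iff {g : F → EReal} (hg : ∀ w, g w ≠ ⊥) {v : F} {c : ℝ} :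
    conj g v ≤ c ↔ ∀ (w : F) (r : ℝ), g w = r → ⟪v, w⟫ - r ≤ c := by
  constructor
  · intro H w r hw
    exact_mod_cast (coe_le_conj hw v).trans H
  · refine fun H => iSup_le fun w => ?_
    by_cases htop : g w = ⊤
    · simp [htop]
    · obtain ⟨r, hr⟩ := exists_coe_eq (hg w) htop
      rw [hr]
      exact_mod_cast H w r hr

theorem conj_ne_bot {g : F → EReal} (hg : ProperFn g) (v : F) : conj g v ≠ ⊥ := by
  obtain ⟨w, hw⟩ := hg.2
  obtain ⟨r, hr⟩ := exists_coe_eq (hg.1 w) hw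
  exact ne_bot_of_le_ne_bot (EReal.coe_ne_bot _) (coe_le_conj hr v)

theorem conj_add_smul_le {g : F → EReal} (hg : ∀ w, g w ≠ ⊥) {v ζ : F} {c d t : ℝ}
    (hv : conj g v = c) (hζ : conj g ζ = d) (ht : t ∈ Ioo (0 : ℝ) 1) :
    conj g (v + t • (ζ - v)) ≤ ((c + t * (d - c) : ℝ) : EReal) := by
  rw [conj_le_coe_iff hg]
  intro w r hw
  have h1 := (conj_le_coe_iff hg).1 hv.le w r hw
  have h2 := (conj_le_coe_iff hg).1 hζ.le w r hw
  rw [inner_add_left, real_inner_smul_left, inner_sub_left]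
  nlinarith [ht.1, ht.2, mul_nonneg (sub_nonneg.2 ht.2.le) (sub_nonneg.2 h1),
    mul_nonneg ht.1.le (sub_nonneg.2 h2)]

theorem conj_ne_top_of_mem_subdiff {g : F → EReal} (hg : ∀ w, g w ≠ ⊥) {w v : F}
    (hv : v ∈ subdiff g w) : conj g v ≠ ⊤ := by
  obtain ⟨r, hr⟩ := exists_coe_eq (hg w) hv.1
  refine ne_top_of_le_ne_top (EReal.coe_ne_top (⟪v, w⟫ - r)) ((conj_le_coe_iff hg).2 ?_)
  intro w' r' hw'
  have := hv.2 w'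
  rw [hr, hw'] at this
  have : r + (⟪v, w' - w⟫ - 0) ≤ r' := by exact_mod_cast this
  rw [inner_sub_right] at this
  linarith

/-- `z` minimizes `ζ ↦ g* ζ - ⟪ζ, a⟫ + (γ / 2) ‖ζ‖²`. -/
def IsConjProx (g : F → EReal) (γ : ℝ) (a z : F) : Prop :=
  ∀ ζ : F, conj g z + ((-⟪z, a⟫ + γ / 2 * ‖z‖ ^ 2 : ℝ) : EReal)
      ≤ conj g ζ + ((-⟪ζ, a⟫ + γ / 2 * ‖ζ‖ ^ 2 : ℝ) : EReal)

theorem IsConjProx.exists_conj_eq {g : F → EReal} (hg : ProperFn g) {γ : ℝ} {a z : F}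
    (hz : IsConjProx g γ a z) (hne : (subdiff g a).Nonempty) : ∃ c : ℝ, conj g z = c := by
  obtain ⟨v, hv⟩ := hne
  obtain ⟨d, hd⟩ := exists_coe_eq (conj_ne_bot hg v) (conj_ne_top_of_mem_subdiff hg.1 hv)
  refine exists_coe_eq (conj_ne_bot hg z) fun htop => ?_
  have := hz v
  rw [htop, hd, EReal.top_add_coe, ← EReal.coe_add, top_le_iff] at this
  exact EReal.coe_ne_top _ this

/-- Strong convexity of the proximal objective, at its minimizer. -/
theorem IsConjProx.add_sq_le {g : F → EReal} (hg : ∀ w, g w ≠ ⊥) {γ : ℝ} {a z ζ : F} {c d : ℝ}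
    (hz : IsConjProx g γ a z) (hc : conj g z = c) (hd : conj g ζ = d) :
    c - ⟪z, a⟫ + γ / 2 * ‖z‖ ^ 2 + γ / 2 * ‖ζ - z‖ ^ 2 ≤ d - ⟪ζ, a⟫ + γ / 2 * ‖ζ‖ ^ 2 := by
  have key : 0 ≤ d - c - ⟪ζ - z, a⟫ + γ * ⟪z, ζ - z⟫ := by
    refine nonneg_of_forall_linear_add_sq (q := γ / 2 * ‖ζ - z‖ ^ 2) fun t ht => ?_
    have h1 := (hz (z + t • (ζ - z))).trans
      (add_le_add_left (conj_add_smul_le hg hc hd ht) _)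
    rw [hc] at h1
    have h2 : c + (-⟪z, a⟫ + γ / 2 * ‖z‖ ^ 2) ≤ c + t * (d - c)
        + (-⟪z + t • (ζ - z), a⟫ + γ / 2 * ‖z + t • (ζ - z)‖ ^ 2) := by exact_mod_cast h1
    rw [norm_add_smul_sq, inner_add_left, real_inner_smul_left] at h2
    linarith
  have hsq := norm_add_smul_sq z (ζ - z) 1
  rw [one_smul, add_sub_cancel] at hsq
  rw [inner_sub_left] at key
  rw [hsq]
  linarith

/-- The proximal point depends in a Lipschitz way on its argument. -/
theorem IsConjProx.norm_sub_le {g : F → EReal} (hg : ∀ w, g w ≠ ⊥) {γ : ℝ} (hγ : 0 < γ)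
    {a b z ζ : F} {c d : ℝ} (hz : IsConjProx g γ a z) (hζ : IsConjProx g γ b ζ)
    (hc : conj g z = c) (hd : conj g ζ = d) : ‖ζ - z‖ ≤ ‖b - a‖ / γ := by
  have h1 := hz.add_sq_le hg hc hd
  have h2 := hζ.add_sq_le hg hd hc
  rw [norm_sub_rev z ζ] at h2
  have h3 : γ * ‖ζ - z‖ ^ 2 ≤ ⟪ζ - z, b - a⟫ := by
    simp only [inner_sub_left, inner_sub_right]
    linarith
  have h4 := h3.trans (real_inner_le_norm _ _)
  rw [le_div_iff₀ hγ]
  rcases (norm_nonneg (ζ - z)).eq_or_lt with h0 | h0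
  · rw [← h0, zero_mul]; exact norm_nonneg _
  · refine le_of_mul_le_mul_left ?_ h0
    linarith

/-- Strong convexity of a linear functional plus a quadratic, at a minimizer over a convex set. -/
theorem add_sq_le_of_isMinOn {S : Set E} (hS : Convex ℝ S) (φ : E →ₗ[ℝ] ℝ) {δ : ℝ} {u p w : E}
    (hp : p ∈ S) (hmin : ∀ v ∈ S, φ p + δ / 2 * ‖p - u‖ ^ 2 ≤ φ v + δ / 2 * ‖v - u‖ ^ 2)
    (hw : w ∈ S) :
    φ p + δ / 2 * ‖p - u‖ ^ 2 + δ / 2 * ‖w - p‖ ^ 2 ≤ φ w + δ / 2 * ‖w - u‖ ^ 2 := by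
  have key : 0 ≤ φ (w - p) + δ * ⟪p - u, w - p⟫ := by
    refine nonneg_of_forall_linear_add_sq (q := δ / 2 * ‖w - p‖ ^ 2) fun t ht => ?_
    have h1 := hmin _ (hS.add_smul_sub_mem hp hw ⟨ht.1.le, ht.2.le⟩)
    rw [add_sub_right_comm, norm_add_smul_sq, map_add, map_smul, smul_eq_mul] at h1
    linarith
  have hsq := norm_add_smul_sq (p - u) (w - p) 1
  rw [one_smul, show p - u + (w - p) = w - u by abel] at hsq
  rw [map_sub] at key
  rw [hsq]
  linarith

/-- The descent lemma on a convex set. -/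
theorem descent_le {S : Set E} (hS : Convex ℝ S) {h : E → ℝ} {h' : E → E} {L : ℝ}
    (hgrad : ∀ x ∈ S, HasGradientAt h (h' x) x)
    (hlip : ∀ x ∈ S, ∀ y ∈ S, ‖h' x - h' y‖ ≤ L * ‖x - y‖) {a b : E} (ha : a ∈ S) (hb : b ∈ S) :
    h b ≤ h a + ⟪h' a, b - a⟫ + L / 2 * ‖b - a‖ ^ 2 := by
  have hmem : ∀ t ∈ Icc (0 : ℝ) 1, a + t • (b - a) ∈ S := fun t ht => hS.add_smul_sub_mem ha hb ht
  have hder : ∀ t ∈ Icc (0 : ℝ) 1, HasDerivAt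
      (fun s : ℝ => h (a + s • (b - a)) - s * ⟪h' a, b - a⟫ - s ^ 2 * (L / 2 * ‖b - a‖ ^ 2))
      (⟪h' (a + t • (b - a)), b - a⟫ - ⟪h' a, b - a⟫ - 2 * t * (L / 2 * ‖b - a‖ ^ 2)) t := by
    intro t ht
    have hline : HasDerivAt (fun s : ℝ => a + s • (b - a)) (b - a) t := by
      simpa using ((hasDerivAt_id t).smul_const (b - a)).const_add a
    have h1 := (hgrad _ (hmem t ht)).hasFDerivAt.comp_hasDerivAt t hline
    have h2 := (hasDerivAt_id t).mul_const ⟪h' a, b - a⟫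
    have h3 := (hasDerivAt_pow 2 t).mul_const (L / 2 * ‖b - a‖ ^ 2)
    refine ((h1.sub h2).sub h3).congr_deriv ?_
    simp [InnerProductSpace.toDual_apply_apply]
  have hanti := antitoneOn_of_deriv_nonpos (convex_Icc (0 : ℝ) 1)
    (fun t ht => (hder t ht).continuousAt.continuousWithinAt)
    (fun t ht => (hder t (interior_subset ht)).differentiableAt.differentiableWithinAt)
    (fun t ht => by
      have ht' := interior_subset ht
      rw [(hder t ht').deriv, ← inner_sub_left]
      have h1 := (real_inner_le_norm (h' (a + t • (b - a)) - h' a) (b - a)).trans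
        (mul_le_mul_of_nonneg_right (hlip _ (hmem t ht') a ha) (norm_nonneg _))
      rw [add_sub_cancel_left, norm_smul, Real.norm_of_nonneg ht'.1] at h1
      linarith)
  have := hanti (left_mem_Icc.2 zero_le_one) (right_mem_Icc.2 zero_le_one) zero_le_one
  simp only [one_smul, zero_smul, add_zero, add_sub_cancel] at this
  linarith

theorem ConvexFn.convexOn_toReal {f : F → EReal} (hf : ProperFn f) (hc : ConvexFn f) :
    ConvexOn ℝ (edom f) (fun w => (f w).toReal) := by
  have key : ∀ x ∈ edom f, ∀ y ∈ edom f, ∀ a b : ℝ, 0 ≤ a → 0 ≤ b → a + b = 1 →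
      f (a • x + b • y) ≤ ((a * (f x).toReal + b * (f y).toReal : ℝ) : EReal) := by
    intro x hx y hy a b ha hb hab
    have := hc x y a b ha hb hab
    obtain ⟨r, hr⟩ := exists_coe_eq (hf.1 x) hx
    obtain ⟨s, hs⟩ := exists_coe_eq (hf.1 y) hy
    rw [hr, hs] at this ⊢
    exact_mod_cast this
  refine ⟨fun x hx y hy a b ha hb hab =>
    ne_top_of_le_ne_top (EReal.coe_ne_top _) (key x hx y hy a b ha hb hab), ?_⟩
  intro x hx y hy a b ha hb hab
  exact EReal.toReal_le_toReal (key x hx y hy a b ha hb hab) (hf.1 _) (EReal.coe_ne_top _)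

/-- A convex function is bounded above on a neighbourhood of a compact subset of the interior
of its domain. -/
theorem ConvexFn.exists_le_of_isCompact {f : F → EReal} (hf : ProperFn f) (hc : ConvexFn f)
    {C : Set F} (hC : IsCompact C) (hCf : C ⊆ interior (edom f)) :
    ∃ r B : ℝ, 0 < r ∧ ∀ w ∈ C, ∀ v, ‖v - w‖ ≤ r → f v ≤ B := by
  obtain ⟨r, hr, hrsub⟩ := hC.exists_cthickening_subset_open isOpen_interior hCf
  obtain ⟨B, hB⟩ := hC.cthickening.bddAbove_image
    ((hc.convexOn_toReal hf).continuousOn_interior.mono hrsub)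
  refine ⟨r, B, hr, fun w hw v hv => ?_⟩
  have hvC : v ∈ cthickening r C :=
    mem_cthickening_of_dist_le v w r C hw (by rwa [dist_eq_norm])
  rw [← EReal.coe_toReal (interior_subset (hrsub hvC)) (hf.1 v)]
  exact_mod_cast hB (mem_image_of_mem _ hvC)

theorem norm_le_of_mem_subdiff {f : F → EReal} {w y : F} {r B : ℝ} (hr : 0 < r)
    (hB : ∀ v, ‖v - w‖ ≤ r → f v ≤ B) (hpos : 0 ≤ f w) (hy : y ∈ subdiff f w) :
    ‖y‖ ≤ B / r := by
  rw [le_div_iff₀ hr]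
  have hv := hB (w + (r / ‖y‖) • y) (by
    rw [add_sub_cancel_left, norm_smul, Real.norm_of_nonneg (by positivity)]
    rcases eq_or_ne ‖y‖ 0 with h0 | h0
    · rw [h0, mul_zero]; exact hr.le
    · rw [div_mul_cancel₀ _ h0])
  have h1 := (add_le_add_left hpos _).trans ((hy.2 _).trans hv)
  rw [zero_add, add_sub_cancel_left, real_inner_smul_right, real_inner_self_eq_norm_sq] at h1
  have h2 : r / ‖y‖ * ‖y‖ ^ 2 - 0 ≤ B := by exact_mod_cast h1
  rcases eq_or_ne ‖y‖ 0 with h0 | h0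
  · rw [h0] at h2 ⊢; linarith
  · have : r / ‖y‖ * ‖y‖ ^ 2 = ‖y‖ * r := by field_simp
    linarith

theorem nonneg_of_lipschitz_on_open [Nontrivial E] {O : Set E} (hO : IsOpen O) (hne : O.Nonempty)
    {h' : E → E} {L : ℝ} (hlip : ∀ x ∈ O, ∀ y ∈ O, ‖h' x - h' y‖ ≤ L * ‖x - y‖) : 0 ≤ L := by
  obtain ⟨p, hp, q, hq, hpq⟩ : O.Nontrivial := by
    obtain ⟨p, hp⟩ := hne
    exact (infinite_of_mem_nhds p (hO.mem_nhds hp)).nontrivial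
  exact nonneg_of_mul_nonneg_left ((norm_nonneg _).trans (hlip p hp q hq))
    (norm_pos_iff.2 (sub_ne_zero.2 hpq))

theorem exists_bound_of_relaxation {β R : ℝ} (hβ : β ∈ Ioo (0 : ℝ) 2) {x u : ℕ → E}
    (hx : ∀ k, ‖x k‖ ≤ R) (hu : ∀ k, u (k + 1) = (1 - β) • u k + β • x (k + 1)) :
    ∃ C : ℝ, ∀ k, ‖u k‖ ≤ C := by
  have hlt : 0 < 1 - |1 - β| := by
    rw [sub_pos, abs_lt]; constructor <;> linarith [hβ.1, hβ.2]
  refine ⟨max ‖u 0‖ (β * R / (1 - |1 - β|)), fun k => ?_⟩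
  induction k with
  | zero => exact le_max_left _ _
  | succ k ih =>
    set C := max ‖u 0‖ (β * R / (1 - |1 - β|))
    have hC : β * R ≤ C * (1 - |1 - β|) := (div_le_iff₀ hlt).1 (le_max_right _ _)
    calc ‖u (k + 1)‖ ≤ |1 - β| * ‖u k‖ + β * ‖x (k + 1)‖ := by
          rw [hu k]
          refine (norm_add_le _ _).trans_eq ?_
          rw [norm_smul, norm_smul, Real.norm_eq_abs, Real.norm_of_nonneg hβ.1.le]
      _ ≤ |1 - β| * C + β * R := by
          have := hβ.1.le
          gcongr
          exact hx _
      _ ≤ C := by linarith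

/-- Norms vanish in the limit if their weighted squares are dominated by a null sequence. -/
theorem tendsto_norm_zero_of_mul_sq_le {d : ℕ → E} {c : ℝ} (hc : 0 < c) {e : ℕ → ℝ}
    (he : Tendsto e atTop (𝓝 0)) (hle : ∀ k, c * ‖d k‖ ^ 2 ≤ e k) :
    Tendsto (fun k => ‖d k‖) atTop (𝓝 0) := by
  have hsq : Tendsto (fun k => ‖d k‖ ^ 2) atTop (𝓝 0) := by
    refine squeeze_zero (fun k => sq_nonneg _) (fun k => ?_)
      (by simpa using he.div_const c : Tendsto (fun k => e k / c) atTop (𝓝 0))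
    rw [le_div_iff₀ hc]
    linarith [hle k]
  simpa [Real.sqrt_sq (norm_nonneg _)] using hsq.sqrt

theorem psi_eq_coe {S : Set E} {g : F → EReal} (h : E → ℝ) (A : E →L[ℝ] F) (δ γ : ℝ)
    {x : E} {z : F} {c : ℝ} (hx : x ∈ S) (hz : conj g z = c) (u : E) :
    psi S g h A δ γ x z u =
      ((⟪z, A x⟫ + h x + δ / 2 * ‖x - u‖ ^ 2 - γ / 2 * ‖z‖ ^ 2 - c : ℝ) : EReal) := by
  rw [psi, indicatorFn, if_pos hx, hz, add_zero, ← EReal.coe_sub]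

/-- One step of the algorithm: the parametrized objective decreases quadratically. -/
theorem step_decrease {S : Set E} (hS : Convex ℝ S) {g : F → EReal} (hg : ∀ w, g w ≠ ⊥)
    {h : E → ℝ} {h' : E → E} {L : ℝ} (hgrad : ∀ x ∈ S, HasGradientAt h (h' x) x)
    (hlip : ∀ x ∈ S, ∀ y ∈ S, ‖h' x - h' y‖ ≤ L * ‖x - y‖)
    (A : E →L[ℝ] F) (K : E →L[ℝ] G) {γ ν β δ : ℝ} (hγ : 0 < γ) (hβ : 0 < β)
    (hδ : δ = 2 * ν + L + 2 * ‖A‖ ^ 2 / γ)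
    {x x₁ u u₁ : E} {y : G} {z z₁ : F} {θ c c₁ r r₁ : ℝ} (hx : x ∈ S) (hx₁ : x₁ ∈ S)
    (hz : IsConjProx g γ (A x) z) (hz₁ : IsConjProx g γ (A x₁) z₁)
    (hc : conj g z = c) (hc₁ : conj g z₁ = c₁) (hθ : 0 ≤ θ)
    (hθr : θ * r = ⟪z, A x⟫ + h x + δ / 2 * ‖x - u‖ ^ 2 - γ / 2 * ‖z‖ ^ 2 - c)
    (hy : r + ⟪y, K x₁ - K x⟫ ≤ r₁)
    (hmin : ∀ w ∈ S, ⟪z, A x₁⟫ - θ * ⟪K x₁, y⟫ + ⟪h' x, x₁⟫ + δ / 2 * ‖x₁ - u‖ ^ 2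
        ≤ ⟪z, A w⟫ - θ * ⟪K w, y⟫ + ⟪h' x, w⟫ + δ / 2 * ‖w - u‖ ^ 2)
    (hu : u₁ = (1 - β) • u + β • x₁) :
    ⟪z₁, A x₁⟫ + h x₁ + δ / 2 * ‖x₁ - u₁‖ ^ 2 - γ / 2 * ‖z₁‖ ^ 2 - c₁ ≤
      θ * r₁ - (ν * ‖x - x₁‖ ^ 2 + δ * (2 - β) / (2 * β) * ‖u - u₁‖ ^ 2
        + γ / 2 * ‖z - z₁‖ ^ 2) := by
  let φ : E →ₗ[ℝ] ℝ := (innerₛₗ ℝ z) ∘ₗ A.toLinearMap - θ • ((innerₛₗ ℝ y) ∘ₗ K.toLinearMap)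
    + innerₛₗ ℝ (h' x)
  have hφ : ∀ w, φ w = ⟪z, A w⟫ - θ * ⟪K w, y⟫ + ⟪h' x, w⟫ := fun w => by
    simp [φ, real_inner_comm]
  have hxstep := add_sq_le_of_isMinOn hS φ (δ := δ) (u := u) hx₁
    (by simpa only [hφ] using hmin) hx
  simp only [hφ] at hxstep
  have hdesc := descent_le hS hgrad hlip hx hx₁
  have hzstep := hz.add_sq_le hg hc hc₁
  have hdz := hz.norm_sub_le hg hγ hz₁ hc hc₁
  have hcross : ⟪z₁ - z, A x₁ - A x⟫ ≤ ‖A‖ ^ 2 / γ * ‖x₁ - x‖ ^ 2 := by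
    have hA : ‖A x₁ - A x‖ ≤ ‖A‖ * ‖x₁ - x‖ := by rw [← map_sub]; exact A.le_opNorm _
    calc ⟪z₁ - z, A x₁ - A x⟫ ≤ ‖z₁ - z‖ * ‖A x₁ - A x‖ := real_inner_le_norm _ _
      _ ≤ ‖A x₁ - A x‖ / γ * ‖A x₁ - A x‖ := by gcongr
      _ ≤ (‖A‖ * ‖x₁ - x‖) / γ * (‖A‖ * ‖x₁ - x‖) := by gcongr
      _ = ‖A‖ ^ 2 / γ * ‖x₁ - x‖ ^ 2 := by ring
  have hθy := mul_le_mul_of_nonneg_left hy hθ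
  have hu1 : ‖x₁ - u₁‖ ^ 2 = (1 - β) ^ 2 * ‖x₁ - u‖ ^ 2 := by
    rw [show x₁ - u₁ = (1 - β) • (x₁ - u) by rw [hu]; module, norm_smul, mul_pow,
      Real.norm_eq_abs, sq_abs]
  have hu2 : ‖u - u₁‖ ^ 2 = β ^ 2 * ‖x₁ - u‖ ^ 2 := by
    rw [show u - u₁ = (-β) • (x₁ - u) by rw [hu]; module, norm_smul, mul_pow,
      Real.norm_eq_abs, sq_abs, neg_sq]
  have hu3 : δ * (2 - β) / (2 * β) * ‖u - u₁‖ ^ 2 = δ / 2 * (β * (2 - β)) * ‖x₁ - u‖ ^ 2 := by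
    rw [hu2]; field_simp
  rw [hu3, hu1, norm_sub_rev x x₁, norm_sub_rev z z₁]
  rw [norm_sub_rev x x₁] at hxstep
  have hδ2 : δ / 2 * ‖x₁ - x‖ ^ 2 = ν * ‖x₁ - x‖ ^ 2 + L / 2 * ‖x₁ - x‖ ^ 2
      + ‖A‖ ^ 2 / γ * ‖x₁ - x‖ ^ 2 := by rw [hδ]; ring
  simp only [inner_sub_left, inner_sub_right, real_inner_comm y] at *
  linarith

/-- monotonicity of `θ`, vanishing increments, and boundedness. -/
theorem theta_monotone_and_bounded
    (S : Set E) (g : F → EReal) (h : E → ℝ) (h' : E → E) (Lh : ℝ)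
    (f : G → EReal) (A : E →L[ℝ] F) (K : E →L[ℝ] G)
    (hA1 : Assumption1 S g h h' Lh f A K) (hA2 : Assumption2 S g A)
    (γ ν β δ : ℝ) (hγ : 0 < γ) (hν : 0 < ν) (hβ : β ∈ Ioo (0 : ℝ) 2)
    (hδ : δ = 2 * ν + Lh + 2 * ‖A‖ ^ 2 / γ)
    (x u : ℕ → E) (y : ℕ → G) (z : ℕ → F) (θ : ℕ → ℝ)
    (halg : IsAlgoSeq S g h h' f A K γ δ β x u y z θ) :
    (∀ k, θ (k + 1) ≤ θ k) ∧
    (∃ θbar : ℝ, 0 ≤ θbar ∧ Tendsto θ atTop (nhds θbar)) ∧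
    ((⨆ x' ∈ S, f (K x')) ≠ ⊤ ∧
      ∀ k, θ (k + 1) ≤ θ k - 1 / (⨆ x' ∈ S, f (K x')).toReal *
        (ν * ‖x k - x (k + 1)‖ ^ 2 + δ * (2 - β) / (2 * β) * ‖u k - u (k + 1)‖ ^ 2
          + γ / 2 * ‖z k - z (k + 1)‖ ^ 2)) ∧
    Tendsto (fun k => ‖x k - x (k + 1)‖) atTop (nhds 0) ∧
    Tendsto (fun k => ‖u k - u (k + 1)‖) atTop (nhds 0) ∧
    Tendsto (fun k => ‖z k - z (k + 1)‖) atTop (nhds 0) ∧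
    ∃ R : ℝ, ∀ k, ‖x k‖ ≤ R ∧ ‖y (k + 1)‖ ≤ R ∧ ‖z k‖ ≤ R ∧ ‖u k‖ ≤ R := by
  obtain ⟨hSne, hS, hScomp, hgp, -, -, ⟨O, hO, hSO, hgrad, hlip⟩, hfp, hfc, -, hKint, hfpos, -,
    -⟩ := hA1
  obtain ⟨hx0, hz, hθ, hy, hxmin, hu⟩ := halg
  have hxS : ∀ k, x k ∈ S := fun k => by
    cases k with
    | zero => exact hx0
    | succ k => exact (hxmin k).1
  have hzp : ∀ k, IsConjProx g γ (A (x k)) (z k) := hz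
  choose c hc using fun k => (hzp k).exists_conj_eq hgp (hA2.1 _ (hxS k))
  have hfin : ∀ w ∈ S, f (K w) ≠ ⊤ := fun w hw => interior_subset (hKint w hw)
  choose r hr using fun k => exists_coe_eq (hfp.1 (K (x k))) (hfin _ (hxS k))
  have hrpos : ∀ k, 0 < r k := fun k => by
    have := hfpos _ (hxS k)
    rw [hr k] at this
    exact_mod_cast this
  obtain ⟨ρ, B, hρ, hB⟩ := hfc.exists_le_of_isCompact hfp (hScomp.image K.continuous)
    (image_subset_iff.2 hKint)
  set M : EReal := ⨆ x' ∈ S, f (K x')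
  have hle : ∀ w ∈ S, f (K w) ≤ M := fun w hw => le_iSup₂ (f := fun x' _ => f (K x')) w hw
  have hMtop : M ≠ ⊤ := by
    refine ne_top_of_le_ne_top (EReal.coe_ne_top B) (iSup₂_le fun w hw => ?_)
    exact hB _ (mem_image_of_mem K hw) _ (by simpa using hρ.le)
  have hMbot : M ≠ ⊥ := ne_bot_of_le_ne_bot (hfp.1 _) (hle _ hx0)
  have hrM : ∀ k, r k ≤ M.toReal := fun k => by
    have := hle _ (hxS k)
    rw [hr k, ← EReal.coe_toReal hMtop hMbot] at this
    exact_mod_cast this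
  have hMpos : 0 < M.toReal := (hrpos 0).trans_le (hrM 0)
  have hθr : ∀ k, θ k * r k = ⟪z k, A (x k)⟫ + h (x k) + δ / 2 * ‖x k - u k‖ ^ 2
      - γ / 2 * ‖z k‖ ^ 2 - c k := fun k => by
    have := (hθ k).2
    rw [hr k, psi_eq_coe h A δ γ (hxS k) (hc k)] at this
    exact_mod_cast this
  have hsub : ∀ k, r k + ⟪y (k + 1), K (x (k + 1)) - K (x k)⟫ ≤ r (k + 1) := fun k => by
    have := (hy k).2 (K (x (k + 1)))
    rw [hr k, hr (k + 1), sub_zero] at this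
    exact_mod_cast this
  have hδpos : 0 < δ ∨ Subsingleton E := by
    rcases subsingleton_or_nontrivial E with hE | hE
    · exact Or.inr hE
    · have := nonneg_of_lipschitz_on_open hO (hSne.mono hSO) hlip
      left
      rw [hδ]
      positivity
  have hβ2 : 0 < 2 - β := sub_pos.2 hβ.2
  have hβ0 : 0 < β := hβ.1
  have hX : ∀ k, 0 ≤ ν * ‖x k - x (k + 1)‖ ^ 2 := fun k => by positivity
  have hZ : ∀ k, 0 ≤ γ / 2 * ‖z k - z (k + 1)‖ ^ 2 := fun k => by positivity
  have hU : ∀ k, 0 ≤ δ * (2 - β) / (2 * β) * ‖u k - u (k + 1)‖ ^ 2 := fun k => by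
    rcases hδpos with hδp | hE
    · positivity
    · simp [Subsingleton.elim (u k) (u (k + 1))]
  obtain ⟨D, hD⟩ : ∃ D : ℕ → ℝ, ∀ k, D k = ν * ‖x k - x (k + 1)‖ ^ 2
    + δ * (2 - β) / (2 * β) * ‖u k - u (k + 1)‖ ^ 2 + γ / 2 * ‖z k - z (k + 1)‖ ^ 2 := ⟨_, fun _ => rfl⟩
  have hDnn : ∀ k, 0 ≤ D k := fun k => by linarith [hD k, hX k, hU k, hZ k]
  have hstep : ∀ k, θ (k + 1) * r (k + 1) ≤ θ k * r (k + 1) - D k := fun k => by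
    rw [hθr (k + 1), hD]
    exact step_decrease hS hgp.1 (fun w hw => hgrad w (hSO hw))
      (fun w hw v hv => hlip w (hSO hw) v (hSO hv)) A K hγ hβ0 hδ (hxS k) (hxS (k + 1))
      (hzp k) (hzp (k + 1)) (hc k) (hc (k + 1)) (hθ k).1.le (hθr k) (hsub k) (hxmin k).2 (hu k)
  have hdec : ∀ k, θ (k + 1) ≤ θ k - 1 / M.toReal * D k := fun k => by
    have h1 : D k / r (k + 1) ≤ θ k - θ (k + 1) := by
      rw [div_le_iff₀ (hrpos _)]
      linarith [hstep k]
    have h2 : D k / M.toReal ≤ D k / r (k + 1) :=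
      div_le_div_of_nonneg_left (hDnn k) (hrpos _) (hrM _)
    rw [one_div_mul_eq_div]
    linarith
  have hmono : ∀ k, θ (k + 1) ≤ θ k := fun k =>
    (hdec k).trans (sub_le_self _ (mul_nonneg (by positivity) (hDnn k)))
  have hconv : Tendsto θ atTop (𝓝 (⨅ k, θ k)) :=
    tendsto_atTop_ciInf (antitone_nat_of_succ_le hmono) ⟨0, by rintro _ ⟨k, rfl⟩; exact (hθ k).1.le⟩
  have hlim : Tendsto (fun k => M.toReal * (θ k - θ (k + 1))) atTop (𝓝 0) := by
    simpa using (hconv.sub (hconv.comp (tendsto_add_atTop_nat 1))).const_mul M.toReal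
  have hDle : ∀ k, D k ≤ M.toReal * (θ k - θ (k + 1)) := fun k => by
    have := hdec k
    rw [one_div_mul_eq_div] at this
    rw [mul_comm, ← div_le_iff₀ hMpos]
    linarith
  refine ⟨hmono, ⟨_, ge_of_tendsto' hconv fun k => (hθ k).1.le, hconv⟩, ⟨hMtop, fun k => hD k ▸ hdec k⟩, ?_, ?_, ?_,
    ?_⟩
  · exact tendsto_norm_zero_of_mul_sq_le hν hlim fun k => by linarith [hD k, hDle k, hU k, hZ k]
  · rcases hδpos with hδp | hE
    · exact tendsto_norm_zero_of_mul_sq_le (c := δ * (2 - β) / (2 * β)) (by positivity) hlim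
        fun k => by linarith [hD k, hDle k, hX k, hZ k]
    · simp only [Subsingleton.elim _ (0 : E), norm_zero, tendsto_const_nhds]
  · exact tendsto_norm_zero_of_mul_sq_le (half_pos hγ) hlim
      fun k => by linarith [hD k, hDle k, hX k, hU k]
  · obtain ⟨Rx, hRx⟩ := hScomp.isBounded.exists_norm_le
    have hxb : ∀ k, ‖x k‖ ≤ Rx := fun k => hRx _ (hxS k)
    obtain ⟨Ru, hRu⟩ := exists_bound_of_relaxation hβ hxb hu
    have hyb : ∀ k, ‖y (k + 1)‖ ≤ B / ρ := fun k =>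
      norm_le_of_mem_subdiff hρ (hB _ (mem_image_of_mem K (hxS k))) (hfpos _ (hxS k)).le (hy k)
    have hzb : ∀ k, ‖z k‖ ≤ ‖z 0‖ + ‖A‖ * (Rx + Rx) / γ := fun k => by
      have h1 := (hzp 0).norm_sub_le hgp.1 hγ (hzp k) (hc 0) (hc k)
      have h2 : ‖A (x k) - A (x 0)‖ ≤ ‖A‖ * (Rx + Rx) := by
        rw [← map_sub]
        refine (A.le_opNorm _).trans (mul_le_mul_of_nonneg_left ?_ (norm_nonneg _))
        exact (norm_sub_le _ _).trans (add_le_add (hxb k) (hxb 0))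
      have h3 := div_le_div_of_nonneg_right h2 hγ.le
      linarith [norm_le_norm_add_norm_sub' (z k) (z 0)]
    refine ⟨max (max Rx (B / ρ)) (max (‖z 0‖ + ‖A‖ * (Rx + Rx) / γ) Ru), fun k =>
      ⟨?_, ?_, ?_, ?_⟩⟩
    · exact (hxb k).trans ((le_max_left _ _).trans (le_max_left _ _))
    · exact (hyb k).trans ((le_max_right _ _).trans (le_max_left _ _))
    · exact (hzb k).trans ((le_max_left _ _).trans (le_max_right _ _))
    · exact (hRu k).trans ((le_max_right _ _).trans (le_max_right _ _))

end FracPaper
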